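/- Let t ↦ (a(t), b(t)) be a differentiable curve in ℓ∞(ℤ,ℝ) ⊕ ℓ∞(ℤ,ℝ) with a(n,t) ≠ 0 for all n and t, let H(t) = H(a(t), b(t)) be the associated Jacobi operators, and let P_{2r+2}(t) be the associated Lax operator. Then the Lax equation (d/dt) H(t) − [P_{2r+2}(t), H(t)] = 0 holds for all t if and only if (a(t), b(t)) solves the r-th Toda lattice equation TL_r, i.e., iff for all n and t: ȧ(n,t) = a(n,t)·(g_{r+1}(n+1,t) − g_{r+1}(n,t)) and ḃ(n,t) = h_{r+1}(n,t) − h_{r+1}(n−1,t). -/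

import Mathlib

noncomputable section
open scoped ENNReal

/-- `ℓ²(ℤ,ℝ)`. -/
abbrev L2Z := lp (fun _ : ℤ => ℝ) 2

/-- `ℓ∞(ℤ,ℝ)`. -/
abbrev LinfZ := lp (fun _ : ℤ => ℝ) ∞

/-- The standard orthonormal basis vector `δ_n` of `ℓ²(ℤ)`. -/
def deltaBasis (n : ℤ) : L2Z := lp.single 2 n 1

/-- `H` is the Jacobi operator associated with the bounded sequences `a, b`, i.e.
`(H f)(n) = a n * f (n+1) + a (n-1) * f (n-1) + b n * f n`. -/
def IsJacobiOp (a b : ℤ → ℝ) (H : L2Z →L[ℝ] L2Z) : Prop :=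
  ∀ (f : L2Z) (n : ℤ), H f n = a n * f (n + 1) + a (n - 1) * f (n - 1) + b n * f n

/-- `M` is the operator of multiplication by the (bounded) sequence `m`. -/
def IsMultOp (m : ℤ → ℝ) (M : L2Z →L[ℝ] L2Z) : Prop :=
  ∀ (f : L2Z) (n : ℤ), M f n = m n * f n

/-- `S` is the left shift `(S⁺ f)(n) = f (n+1)`. -/
def IsShiftOp (S : L2Z →L[ℝ] L2Z) : Prop :=
  ∀ (f : L2Z) (n : ℤ), S f n = f (n + 1)

/-- `g_j(n) = ∑_{ℓ=0}^j c_{j-ℓ} ⟨δ_n, H^ℓ δ_n⟩`. -/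
def gCoeff (c : ℕ → ℝ) (H : L2Z →L[ℝ] L2Z) (j : ℕ) (n : ℤ) : ℝ :=
  ∑ l ∈ Finset.range (j + 1), c (j - l) * inner (𝕜 := ℝ) (deltaBasis n) ((H ^ l) (deltaBasis n))

/-- `h_j(n) = 2 a n ∑_{ℓ=0}^j c_{j-ℓ} ⟨δ_{n+1}, H^ℓ δ_n⟩ + c_{j+1}`. -/
def hCoeff (a : ℤ → ℝ) (c : ℕ → ℝ) (H : L2Z →L[ℝ] L2Z) (j : ℕ) (n : ℤ) : ℝ :=
  2 * a n * ∑ l ∈ Finset.range (j + 1),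
      c (j - l) * inner (𝕜 := ℝ) (deltaBasis (n + 1)) ((H ^ l) (deltaBasis n)) + c (j + 1)

/-- `P` is the Lax operator `P_{2r+2}` associated with the Jacobi operator `H` of the
sequences `(a, b)`, namely
`P = -H^{r+1} + ∑_{j=0}^r (M_{2 a g_j} S⁺ - M_{h_j}) H^{r-j} + M_{g_{r+1}}`. -/
def IsLaxOp (r : ℕ) (c : ℕ → ℝ) (a : ℤ → ℝ) (H P : L2Z →L[ℝ] L2Z) : Prop :=
  ∃ S : L2Z →L[ℝ] L2Z, IsShiftOp S ∧
  ∃ MG MH : ℕ → L2Z →L[ℝ] L2Z, ∃ Mg : L2Z →L[ℝ] L2Z,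
    (∀ j : ℕ, IsMultOp (fun n => 2 * a n * gCoeff c H j n) (MG j)) ∧
    (∀ j : ℕ, IsMultOp (hCoeff a c H j) (MH j)) ∧
    IsMultOp (gCoeff c H (r + 1)) Mg ∧
    P = -(H ^ (r + 1)) +
        (∑ j ∈ Finset.range (r + 1), (MG j * S - MH j) * H ^ (r - j)) + Mg
lemma deltaBasis_apply (n k : ℤ) : deltaBasis n k = if k = n then 1 else 0 := by
  simp [deltaBasis, Pi.single_apply]

lemma inner_deltaBasis (n : ℤ) (f : L2Z) : inner (𝕜 := ℝ) (deltaBasis n) f = f n := by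
  simp [deltaBasis, lp.inner_single_left]

namespace IsJacobiOp

variable {a b : ℤ → ℝ} {H : L2Z →L[ℝ] L2Z}

lemma pow_succ_apply (hH : IsJacobiOp a b H) (l : ℕ) (f : L2Z) (i : ℤ) :
    (H ^ (l + 1)) f i =
      a i * (H ^ l) f (i + 1) + a (i - 1) * (H ^ l) f (i - 1) + b i * (H ^ l) f i := by
  rw [pow_succ', mul_apply_eq_comp, hH]

lemma apply_deltaBasis (hH : IsJacobiOp a b H) (k : ℤ) :
    H (deltaBasis k) =
      a k • deltaBasis (k + 1) + a (k - 1) • deltaBasis (k - 1) + b k • deltaBasis k := by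
  ext i
  simp only [hH _ i, lp.coeFn_add, lp.coeFn_smul, Pi.add_apply, Pi.smul_apply, smul_eq_mul,
    deltaBasis_apply]
  rcases eq_or_ne i k with rfl | h₀
  · simp [show i ≠ i - 1 by lia]
  rcases eq_or_ne i (k + 1) with rfl | h₁
  · simp [show k + 1 ≠ k - 1 by lia, show k + 1 + 1 ≠ k by lia]
  rcases eq_or_ne i (k - 1) with rfl | h₂
  · simp [show k - 1 - 1 ≠ k by lia, show k - 1 ≠ k + 1 by lia]
  simp [h₀, h₁, h₂, show i + 1 ≠ k by lia, show i - 1 ≠ k by lia]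

lemma pow_succ_deltaBasis (hH : IsJacobiOp a b H) (l : ℕ) (i k : ℤ) :
    (H ^ (l + 1)) (deltaBasis k) i =
      a k * (H ^ l) (deltaBasis (k + 1)) i + a (k - 1) * (H ^ l) (deltaBasis (k - 1)) i
        + b k * (H ^ l) (deltaBasis k) i := by
  rw [pow_succ, mul_apply_eq_comp, hH.apply_deltaBasis,
    map_add, map_add, map_smul, map_smul, map_smul]
  rfl

lemma pow_deltaBasis_comm (hH : IsJacobiOp a b H) (l : ℕ) (i k : ℤ) :
    (H ^ l) (deltaBasis k) i = (H ^ l) (deltaBasis i) k := by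
  induction l generalizing i k with
  | zero => simp [deltaBasis_apply, eq_comm]
  | succ l ih =>
    rw [hH.pow_succ_apply, hH.pow_succ_deltaBasis, ih (i + 1), ih (i - 1), ih i]

lemma two_mul_gCoeff_succ (hH : IsJacobiOp a b H) (c : ℕ → ℝ) (j : ℕ) (n : ℤ) :
    2 * gCoeff c H (j + 1) n =
      hCoeff a c H j n + hCoeff a c H j (n - 1) + 2 * b n * gCoeff c H j n := by
  simp only [gCoeff, hCoeff, inner_deltaBasis, sub_add_cancel]
  rw [Finset.sum_range_succ']
  simp only [hH.pow_succ_apply, hH.pow_deltaBasis_comm _ (n - 1) n, Nat.add_sub_add_right,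
    pow_zero, one_apply_eq_self, deltaBasis_apply, mul_add, Finset.sum_add_distrib,
    Finset.mul_sum, if_true, Nat.sub_zero, mul_one]
  have e (x y z : ℝ) : 2 * (x * (y * z)) = 2 * y * (x * z) := by ring
  simp only [e]
  ring

lemma hCoeff_succ_sub (hH : IsJacobiOp a b H) (c : ℕ → ℝ) (j : ℕ) (n : ℤ) :
    hCoeff a c H (j + 1) n - hCoeff a c H (j + 1) (n - 1) =
      2 * (a n ^ 2 * gCoeff c H j (n + 1) - a (n - 1) ^ 2 * gCoeff c H j (n - 1))
        + b n * (hCoeff a c H j n - hCoeff a c H j (n - 1)) := by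
  simp only [gCoeff, hCoeff, inner_deltaBasis, sub_add_cancel]
  rw [Finset.sum_range_succ' _ (j + 1), Finset.sum_range_succ' _ (j + 1)]
  simp only [hH.pow_succ_deltaBasis _ (n + 1) n, hH.pow_succ_apply _ (deltaBasis (n - 1)) n,
    Nat.add_sub_add_right, pow_zero, one_apply_eq_self, deltaBasis_apply]
  rw [if_neg (show n + 1 ≠ n by lia), if_neg (show n ≠ n - 1 by lia)]
  have e (x y z : ℝ) : x * (y * z) = y * (x * z) := by ring
  simp only [mul_add, Finset.sum_add_distrib, e (c _), ← Finset.mul_sum]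
  ring

lemma coeff_unique {a' b' : ℤ → ℝ} (h : IsJacobiOp a b H) (h' : IsJacobiOp a' b' H) (n : ℤ) :
    a n = a' n ∧ b n = b' n := by
  constructor
  · have := (h (deltaBasis (n + 1)) n).symm.trans (h' (deltaBasis (n + 1)) n)
    simpa [deltaBasis_apply, show n - 1 ≠ n + 1 by lia] using this
  · have := (h (deltaBasis n) n).symm.trans (h' (deltaBasis n) n)
    simpa [deltaBasis_apply] using this

end IsJacobiOp

/-- The value at `n` of `D_j f`, where `D_j` is the first-order difference operator with
`[M_{2 a g_j} S⁺ - M_{h_j}, H] = D_j H - D_{j+1}`. -/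
def laxRemainder (a : ℤ → ℝ) (c : ℕ → ℝ) (H : L2Z →L[ℝ] L2Z) (j : ℕ) (f : L2Z) (n : ℤ) : ℝ :=
  2 * a n * (gCoeff c H j n - gCoeff c H j (n + 1)) * f (n + 1)
    + (hCoeff a c H j (n - 1) - hCoeff a c H j n) * f n

lemma laxRemainder_zero (a : ℤ → ℝ) (c : ℕ → ℝ) (H : L2Z →L[ℝ] L2Z) (f : L2Z) (n : ℤ) :
    laxRemainder a c H 0 f n = 0 := by
  simp [laxRemainder, gCoeff, hCoeff, inner_deltaBasis, deltaBasis_apply, show n ≠ n - 1 by lia]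

lemma IsJacobiOp.commutator_apply {a b : ℤ → ℝ} {H S G M : L2Z →L[ℝ] L2Z}
    (hH : IsJacobiOp a b H) (c : ℕ → ℝ) (j : ℕ) (hS : IsShiftOp S)
    (hG : IsMultOp (fun n => 2 * a n * gCoeff c H j n) G) (hM : IsMultOp (hCoeff a c H j) M)
    (f : L2Z) (n : ℤ) :
    (G * S - M) (H f) n - H ((G * S - M) f) n =
      laxRemainder a c H j (H f) n - laxRemainder a c H (j + 1) f n := by
  have hA (f : L2Z) (n : ℤ) : (G * S - M) f n =
      2 * a n * gCoeff c H j n * f (n + 1) - hCoeff a c H j n * f n := by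
    simp [hG _ n, hS _ n, hM _ n]
  have h₁ := hH.two_mul_gCoeff_succ c j n
  have h₂ := hH.two_mul_gCoeff_succ c j (n + 1)
  have h₃ := hH.hCoeff_succ_sub c j n
  rw [add_sub_cancel_right] at h₂
  simp only [hH ((G * S - M) f) n, hA, laxRemainder, hH f, sub_add_cancel, add_sub_cancel_right]
  linear_combination a n * f (n + 1) * (h₁ - h₂) - f n * h₃

/-- The commutator `[P, H]` is the Jacobi-type operator given by the right-hand side of the
`r`-th Toda lattice equation. -/
lemma IsLaxOp.isJacobiOp_commutator {r : ℕ} {c : ℕ → ℝ} {a b : ℤ → ℝ} {H P : L2Z →L[ℝ] L2Z}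
    (hP : IsLaxOp r c a H P) (hH : IsJacobiOp a b H) :
    IsJacobiOp (fun n => a n * (gCoeff c H (r + 1) (n + 1) - gCoeff c H (r + 1) n))
      (fun n => hCoeff a c H (r + 1) n - hCoeff a c H (r + 1) (n - 1)) (P * H - H * P) := by
  obtain ⟨S, hS, G, M, Mg, hG, hM, hMg, rfl⟩ := hP
  intro f n
  set A : ℕ → L2Z →L[ℝ] L2Z := fun j => G j * S - M j
  have hcomm : (-(H ^ (r + 1)) + (∑ j ∈ Finset.range (r + 1), A j * H ^ (r - j)) + Mg) * H
      - H * (-(H ^ (r + 1)) + (∑ j ∈ Finset.range (r + 1), A j * H ^ (r - j)) + Mg)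
      = (∑ j ∈ Finset.range (r + 1), (A j * H - H * A j) * H ^ (r - j)) + (Mg * H - H * Mg) := by
    have hsum : ∑ j ∈ Finset.range (r + 1), (A j * H - H * A j) * H ^ (r - j) =
        (∑ j ∈ Finset.range (r + 1), A j * H ^ (r - j)) * H
          - H * ∑ j ∈ Finset.range (r + 1), A j * H ^ (r - j) := by
      rw [Finset.sum_mul, Finset.mul_sum, ← Finset.sum_sub_distrib]
      refine Finset.sum_congr rfl fun j _ => ?_
      rw [sub_mul, mul_assoc, mul_assoc, mul_assoc, ← pow_succ', ← pow_succ]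
    rw [hsum]
    simp only [add_mul, mul_add, neg_mul, mul_neg, ← pow_succ, ← pow_succ']
    abel
  have htel : (∑ j ∈ Finset.range (r + 1), (A j * H - H * A j) * H ^ (r - j)) f n
      = -laxRemainder a c H (r + 1) f n := by
    have hterm : ∀ j ∈ Finset.range (r + 1), ((A j * H - H * A j) * H ^ (r - j)) f n =
        laxRemainder a c H j ((H ^ (r + 1 - j)) f) n
          - laxRemainder a c H (j + 1) ((H ^ (r + 1 - (j + 1))) f) n := by
      intro j hj
      have hj' : r + 1 - j = (r - j) + 1 := by
        have := Finset.mem_range.1 hj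
        lia
      have := hH.commutator_apply c j hS (hG j) (hM j) ((H ^ (r - j)) f) n
      rw [hj', Nat.add_sub_add_right, pow_succ']
      simpa [A] using this
    rw [sum_apply, lp.coeFn_sum, Finset.sum_apply, Finset.sum_congr rfl hterm,
      Finset.sum_range_sub' fun j => laxRemainder a c H j ((H ^ (r + 1 - j)) f) n]
    simp [laxRemainder_zero]
  rw [hcomm]
  simp only [add_apply, lp.coeFn_add, Pi.add_apply, htel,
    sub_apply, lp.coeFn_sub, Pi.sub_apply, mul_apply_eq_comp,
    hMg _ n, hH _ n, hMg _ (n + 1), hMg _ (n - 1), laxRemainder, sub_add_cancel]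
  ring

/-- For a differentiable curve `t ↦ (a(t), b(t))` in
`ℓ∞(ℤ,ℝ) ⊕ ℓ∞(ℤ,ℝ)` with `a(n,t) ≠ 0`, Jacobi operators `H t` and Lax operators
`P t = P_{2r+2}(t)`, the Lax equation `(d/dt) H t - [P t, H t] = 0` (where `(d/dt) H t`
is the Jacobi-type operator with coefficients `(ȧ(t), ḃ(t))`) holds for all `t`
if and only if `(a, b)` solves the `r`-th Toda lattice equation `TL_r`, i.e. iff
`ȧ(n,t) = a(n,t) (g_{r+1}(n+1,t) - g_{r+1}(n,t))` and
`ḃ(n,t) = h_{r+1}(n,t) - h_{r+1}(n-1,t)` for all `n` and `t`. -/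
theorem lax_equation_iff_toda (r : ℕ) (c : ℕ → ℝ) (hc0 : c 0 = 1)
    (hc : ∀ j : ℕ, r < j → c j = 0)
    (u : ℝ → LinfZ × LinfZ) (hdiff : Differentiable ℝ u)
    (hnz : ∀ (t : ℝ) (n : ℤ), (u t).1 n ≠ 0)
    (H : ℝ → L2Z →L[ℝ] L2Z)
    (hH : ∀ t : ℝ, IsJacobiOp (fun n => (u t).1 n) (fun n => (u t).2 n) (H t))
    (P : ℝ → L2Z →L[ℝ] L2Z)
    (hP : ∀ t : ℝ, IsLaxOp r c (fun n => (u t).1 n) (H t) (P t)) :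
    (∀ t : ℝ, ∃ dH : L2Z →L[ℝ] L2Z,
        IsJacobiOp (fun n => deriv (fun s : ℝ => (u s).1 n) t)
          (fun n => deriv (fun s : ℝ => (u s).2 n) t) dH ∧
        dH - (P t * H t - H t * P t) = 0)
    ↔ (∀ (t : ℝ) (n : ℤ),
        deriv (fun s : ℝ => (u s).1 n) t =
          (u t).1 n * (gCoeff c (H t) (r + 1) (n + 1) - gCoeff c (H t) (r + 1) n) ∧
        deriv (fun s : ℝ => (u s).2 n) t =
          hCoeff (fun m => (u t).1 m) c (H t) (r + 1) n
            - hCoeff (fun m => (u t).1 m) c (H t) (r + 1) (n - 1)) := by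
  refine forall_congr' fun t => ?_
  have hcomm := (hP t).isJacobiOp_commutator (hH t)
  constructor
  · rintro ⟨dH, hdH, hlax⟩ n
    rw [sub_eq_zero.1 hlax] at hdH
    exact hdH.coeff_unique hcomm n
  · intro htoda
    refine ⟨P t * H t - H t * P t, ?_, sub_self _⟩
    convert hcomm using 2 with n n
    · exact (htoda n).1
    · exact (htoda n).2
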